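/- Let a be a nonzero real number, let p and q be real numbers that are not integers but whose sum p+q is an integer, and let n be an integer with n ≥ p+q−1. Then for every real polynomial P of degree at most n there exists a real polynomial P̃ of degree at most n such that, at every point x with x > 0 and a + x > 0, the (n+1−(p+q))-th derivative of the function x ↦ P(x)/(x^p · (a+x)^q) equals P̃(x)/(x^{n+1−q} · (a+x)^{n+1−p}). -/

import Mathlib

lemma contDiffAt_rpow_mul_add_rpow (k : WithTop ℕ∞) (a α β : ℝ) {x : ℝ} (hx : 0 < x)
    (hax : 0 < a + x) : ContDiffAt ℝ k (fun t : ℝ => t ^ α * (a + t) ^ β) x :=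
  (contDiffAt_id.rpow_const_of_ne hx.ne').mul
    ((contDiffAt_const.add contDiffAt_id).rpow_const_of_ne hax.ne')

lemma contDiffAt_eval_div_rpow (k : WithTop ℕ∞) (P : Polynomial ℝ) (a p q : ℝ) {x : ℝ}
    (hx : 0 < x) (hax : 0 < a + x) :
    ContDiffAt ℝ k (fun t : ℝ => P.eval t / (t ^ p * (a + t) ^ q)) x :=
  P.contDiff_aeval k |>.contDiffAt.div (contDiffAt_rpow_mul_add_rpow k a p q hx hax)
    (mul_pos (Real.rpow_pos_of_pos hx _) (Real.rpow_pos_of_pos hax _)).ne'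

lemma eventually_pos_and_add_pos (a : ℝ) {x : ℝ} (hx : 0 < x) (hax : 0 < a + x) :
    ∀ᶠ t in nhds x, 0 < t ∧ 0 < a + t :=
  (continuousAt_id.eventually (lt_mem_nhds hx)).and
    ((continuous_const.add continuous_id).continuousAt.eventually (lt_mem_nhds hax))

lemma iteratedDeriv_succ_id_mul {u : ℝ → ℝ} {x : ℝ} (k : ℕ)
    (hu : ContDiffAt ℝ (k + 1 : ℕ) u x) :
    iteratedDeriv (k + 1) (fun t => t * u t) x
      = x * iteratedDeriv (k + 1) u x + (k + 1) * iteratedDeriv k u x := by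
  rw [iteratedDeriv_fun_mul contDiffAt_fun_id hu, Finset.sum_range_succ', Finset.sum_range_succ']
  simp [iteratedDeriv_fun_id, add_comm]

/-- If `α + β = N - 1`, the `N`-th derivative of `x ^ α * (a + x) ^ β` is again a single product
of powers. -/
lemma iteratedDeriv_rpow_mul_add_rpow (a : ℝ) (N : ℕ) (α β : ℝ) (h : α + β = N - 1) {x : ℝ}
    (hx : 0 < x) (hax : 0 < a + x) :
    iteratedDeriv N (fun t : ℝ => t ^ α * (a + t) ^ β) x
      = a ^ N * (descPochhammer ℝ N).eval α * (x ^ (α - N) * (a + x) ^ (β - N)) := by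
  induction N generalizing α x with
  | zero => simp
  | succ N ih =>
    push_cast at h
    have ih' {t : ℝ} (ht : 0 < t) (hat : 0 < a + t) := ih (α - 1) (by linarith) ht hat
    have hfactor : (fun t : ℝ => t ^ α * (a + t) ^ β)
        =ᶠ[nhds x] fun t => t * (t ^ (α - 1) * (a + t) ^ β) := by
      filter_upwards [eventually_pos_and_add_pos a hx hax] with t ht
      rw [← mul_assoc, Real.rpow_sub_one ht.1.ne', mul_div_cancel₀ _ ht.1.ne']
    have hderiv : iteratedDeriv (N + 1) (fun t : ℝ => t ^ (α - 1) * (a + t) ^ β) x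
        = a ^ N * (descPochhammer ℝ N).eval (α - 1) *
          ((α - 1 - N) * x ^ (α - 1 - N - 1) * (a + x) ^ (β - N)
            + x ^ (α - 1 - N) * ((β - N) * (a + x) ^ (β - N - 1))) := by
      have hev : iteratedDeriv N (fun t : ℝ => t ^ (α - 1) * (a + t) ^ β) =ᶠ[nhds x] fun t =>
          a ^ N * (descPochhammer ℝ N).eval (α - 1) *
            (t ^ (α - 1 - N) * (a + t) ^ (β - N)) := by
        filter_upwards [eventually_pos_and_add_pos a hx hax] with t ht using ih' ht.1 ht.2
      rw [iteratedDeriv_succ, hev.deriv_eq]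
      have h₁ := Real.hasDerivAt_rpow_const (p := α - 1 - N) (Or.inl hx.ne')
      have h₂ := ((hasDerivAt_id x).const_add a).rpow_const (p := β - N) (Or.inl hax.ne')
      simpa using ((h₁.mul h₂).const_mul (a ^ N * (descPochhammer ℝ N).eval (α - 1))).deriv
    rw [hfactor.iteratedDeriv_eq, iteratedDeriv_succ_id_mul N
      (contDiffAt_rpow_mul_add_rpow _ a _ _ hx hax), hderiv, ih' hx hax,
      descPochhammer_succ_left]
    have hβ : β = N - α := by linarith
    have e₁ : α - ((N + 1 : ℕ) : ℝ) = α - 1 - N := by push_cast; ring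
    have e₂ : β - ((N + 1 : ℕ) : ℝ) = β - N - 1 := by push_cast; ring
    rw [e₁, e₂, Real.rpow_sub_one hx.ne', Real.rpow_sub_one hax.ne', hβ]
    simp only [Polynomial.eval_mul, Polynomial.eval_X, Polynomial.eval_comp,
      Polynomial.eval_sub, Polynomial.eval_one]
    field_simp
    ring

open Polynomial in
/-- For `a ≠ 0`, the homogeneous products `X ^ i * (a + X) ^ (n - i)` span the polynomials of
degree at most `n`. -/
lemma mem_span_X_pow_mul_add_X_pow {K : Type*} [Field K] {a : K} (ha : a ≠ 0) {n : ℕ} {P : K[X]}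
    (hP : P.natDegree ≤ n) :
    P ∈ Submodule.span K
      {Q : K[X] | ∃ i j : ℕ, i + j = n ∧ Q = X ^ i * (C a + X) ^ j} := by
  have hX (k j : ℕ) (hkj : k + j = n) :
      C a ^ j * X ^ k ∈ Submodule.span K
        {Q : K[X] | ∃ i j : ℕ, i + j = n ∧ Q = X ^ i * (C a + X) ^ j} := by
    have hexp : C a ^ j * X ^ k = ∑ i ∈ Finset.range (j + 1),
        ((-1) ^ i * (j.choose i : K)) • (X ^ (k + i) * (C a + X) ^ (j - i)) := by
      have : C a = -X + (C a + X) := by ring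
      rw [this, add_pow, Finset.sum_mul, ← this]
      refine Finset.sum_congr rfl fun i _ => ?_
      rw [smul_eq_C_mul, neg_pow, pow_add]
      simp only [C_mul, C_pow, C_neg, C_1, map_natCast]
      ring
    rw [hexp]
    refine Submodule.sum_mem _ fun i hi => Submodule.smul_mem _ _ (Submodule.subset_span ?_)
    have := Finset.mem_range.1 hi
    exact ⟨k + i, j - i, by omega, rfl⟩
  rw [P.as_sum_range_C_mul_X_pow' (Nat.lt_succ_of_le hP)]
  refine Submodule.sum_mem _ fun k hk => ?_
  have hk' := Finset.mem_range.1 hk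
  have hmem := Submodule.smul_mem _ (P.coeff k / a ^ (n - k)) (hX k (n - k) (by omega))
  rwa [smul_eq_C_mul, ← C_pow, ← mul_assoc, ← C_mul,
    div_mul_cancel₀ _ (pow_ne_zero _ ha)] at hmem


/-- Let `a ≠ 0`, let `p, q` be non-integer reals whose sum `p + q = m` is an
integer, and let `n ≥ p + q - 1` be a natural number. Then for every real polynomial `P` of
degree at most `n` there is a real polynomial `P̃` of degree at most `n` such that the
`(n + 1 - (p + q))`-th derivative of `x ↦ P(x) / (x^p (a+x)^q)` equals
`P̃(x) / (x^(n+1-q) (a+x)^(n+1-p))` at every `x` with `x > 0` and `a + x > 0`. -/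
theorem stmt0 (a p q : ℝ) (ha : a ≠ 0)
    (hp : ∀ k : ℤ, p ≠ (k : ℝ)) (hq : ∀ k : ℤ, q ≠ (k : ℝ))
    (m : ℤ) (hpq : p + q = (m : ℝ))
    (n : ℕ) (hn : (n : ℝ) ≥ p + q - 1)
    (P : Polynomial ℝ) (hP : P.natDegree ≤ n) :
    ∃ Pt : Polynomial ℝ, Pt.natDegree ≤ n ∧
      ∀ x : ℝ, 0 < x → 0 < a + x →
        iteratedDeriv (((n : ℤ) + 1 - m).toNat)
            (fun t : ℝ => P.eval t / (t ^ p * (a + t) ^ q)) x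
          = Pt.eval x / (x ^ ((n : ℝ) + 1 - q) * (a + x) ^ ((n : ℝ) + 1 - p)) := by

  obtain ⟨N, hN⟩ : ∃ N : ℕ, (n : ℤ) + 1 - m = N := by
    refine Int.eq_ofNat_of_zero_le ?_
    have : (m : ℝ) ≤ (n : ℝ) + 1 := by linarith
    have : m ≤ (n : ℤ) + 1 := by exact_mod_cast this
    omega
  have hNr : (n : ℝ) + 1 - (p + q) = N := by rw [hpq]; exact_mod_cast hN
  rw [hN, Int.toNat_natCast]
  refine Submodule.span_induction
    (p := fun P _ => ∃ Pt : Polynomial ℝ, Pt.natDegree ≤ n ∧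
      ∀ x : ℝ, 0 < x → 0 < a + x →
        iteratedDeriv N (fun t : ℝ => P.eval t / (t ^ p * (a + t) ^ q)) x
          = Pt.eval x / (x ^ ((n : ℝ) + 1 - q) * (a + x) ^ ((n : ℝ) + 1 - p)))
    ?_ ⟨0, by simp, fun x _ _ => by simp⟩ ?_ ?_ (mem_span_X_pow_mul_add_X_pow ha hP)
  · rintro _ ⟨i, j, hij, rfl⟩
    have hijr : (i : ℝ) + j = n := by exact_mod_cast hij
    refine ⟨Polynomial.C (a ^ N * (descPochhammer ℝ N).eval (i - p)) *
      (Polynomial.X ^ i * (Polynomial.C a + Polynomial.X) ^ j), ?_, fun x hx hax => ?_⟩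
    · subst hij
      compute_degree
    · have hfun : (fun t : ℝ => (Polynomial.X ^ i * (Polynomial.C a + Polynomial.X) ^ j).eval t
          / (t ^ p * (a + t) ^ q)) =ᶠ[nhds x] fun t => t ^ (i - p) * (a + t) ^ (j - q) := by
        filter_upwards [eventually_pos_and_add_pos a hx hax] with t ht
        rw [Real.rpow_sub ht.1, Real.rpow_sub ht.2]
        simp [mul_div_mul_comm]
      rw [hfun.iteratedDeriv_eq,
        iteratedDeriv_rpow_mul_add_rpow a N _ _ (by linarith) hx hax,
        show (i : ℝ) - p - N = i - (n + 1 - q) by linarith,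
        show (j : ℝ) - q - N = j - (n + 1 - p) by linarith, Real.rpow_sub hx, Real.rpow_sub hax]
      simp only [Polynomial.eval_mul, Polynomial.eval_C, Polynomial.eval_pow, Polynomial.eval_X,
        Polynomial.eval_add, Real.rpow_natCast]
      rw [mul_div_assoc, mul_div_mul_comm]
  · rintro P Q - - ⟨P', hP', hP⟩ ⟨Q', hQ', hQ⟩
    refine ⟨P' + Q', Polynomial.natDegree_add_le_of_degree_le hP' hQ', fun x hx hax => ?_⟩
    simp only [Polynomial.eval_add, add_div]
    rw [iteratedDeriv_fun_add (contDiffAt_eval_div_rpow _ P a p q hx hax)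
      (contDiffAt_eval_div_rpow _ Q a p q hx hax), hP x hx hax, hQ x hx hax]
  · rintro c P - ⟨P', hP', hP⟩
    refine ⟨c • P', (Polynomial.natDegree_smul_le c P').trans hP', fun x hx hax => ?_⟩
    simp only [Polynomial.eval_smul, smul_eq_mul, mul_div_assoc]
    rw [iteratedDeriv_const_mul_field, hP x hx hax]
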